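/- Let d ≥ 1, β ∈ (0,d], let Q ⊂ ℝ^d be a cube, and let f ∈ L¹(ℝ^d; 𝓗^{β,Q}_∞) be nonnegative. Then for 𝓗^β-almost every x ∈ ℝ^d (with respect to the β-dimensional Hausdorff measure 𝓗^β), limsup_{Q' → x} l(Q')^{-β} ∫_{Q'} f d𝓗^{β,Q}_∞ = f(x), where the limit superior is taken over cubes Q' ∈ 𝓓(Q) containing x as l(Q') → 0. -/

import Mathlib

open Set MeasureTheory ENNReal NNReal Filter

noncomputable section

/-- `ℝ^d` with the Euclidean metric. -/
abbrev Euc (d : ℕ) : Type := EuclideanSpace ℝ (Fin d)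

/-- An axis-parallel cube in `ℝ^d`, given by its lower corner and (positive) side length. -/
structure Cube (d : ℕ) where
  corner : Fin d → ℝ
  side : ℝ
  side_pos : 0 < side

namespace Cube

/-- The (half-open) set of points of the cube. -/
def set {d : ℕ} (Q : Cube d) : Set (Euc d) :=
  {x : Euc d | ∀ i, Q.corner i ≤ x i ∧ x i < Q.corner i + Q.side}

/-- The dyadic lattice `𝓓(Q)` generated by `Q`: all cubes of side `l(Q)·2ⁿ` (`n : ℤ`) with
corners on the correspondingly rescaled grid anchored at the corner of `Q`; equivalently `Q`,
its dyadic ancestors, and all of their repeated dyadic subdivisions. -/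
def dyadic {d : ℕ} (Q : Cube d) : Set (Cube d) :=
  {Q' | ∃ (n : ℤ) (k : Fin d → ℤ), Q'.side = Q.side * 2 ^ n ∧
    ∀ i, Q'.corner i = Q.corner i + (k i : ℝ) * (Q.side * 2 ^ n)}

end Cube

/-- The spherical Hausdorff content `𝓗^β_∞`, with `ω_β = π^{β/2}/Γ(β/2+1)`. -/
def hausdorffContent (d : ℕ) (β : ℝ) (E : Set (Euc d)) : ℝ≥0∞ :=
  ⨅ (c : ℕ → Euc d × ℝ) (_ : E ⊆ ⋃ i, Metric.ball (c i).1 (c i).2),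
    ∑' i, ENNReal.ofReal (Real.pi ^ (β / 2) / Real.Gamma (β / 2 + 1) * (c i).2 ^ β)

/-- The dyadic Hausdorff content `𝓗^{β,Q}_∞` adapted to the cube `Q`. -/
def dyadicContent (d : ℕ) (β : ℝ) (Q : Cube d) (E : Set (Euc d)) : ℝ≥0∞ :=
  ⨅ (c : ℕ → Cube d) (_ : ∀ i, c i ∈ Q.dyadic) (_ : E ⊆ ⋃ i, (c i).set),
    ∑' i, ENNReal.ofReal ((c i).side ^ β)

/-- The Choquet integral `∫_A f dH := ∫_0^∞ H({x ∈ A : f x > t}) dt`. -/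
def choquetIntegral {X : Type*} (H : Set X → ℝ≥0∞) (A : Set X) (f : X → ℝ) : ℝ≥0∞ :=
  ∫⁻ t in Set.Ioi (0 : ℝ), H {x | x ∈ A ∧ t < f x}

/-- `f` is `H`-quasicontinuous: for every `ε > 0` there is an open set `O` with `H O < ε`
such that `f` restricted to `Oᶜ` is continuous. -/
def QuasiContinuous {X : Type*} [TopologicalSpace X] (H : Set X → ℝ≥0∞) (f : X → ℝ) : Prop :=
  ∀ ε : ℝ, 0 < ε → ∃ O : Set X, IsOpen O ∧ H O < ENNReal.ofReal ε ∧ ContinuousOn f Oᶜ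

/-- `f ∈ L¹(A; H)`: `f` is `H`-quasicontinuous and `∫_A |f| dH < ∞`. -/
def MemChoquetL1 {X : Type*} [TopologicalSpace X] (H : Set X → ℝ≥0∞) (A : Set X)
    (f : X → ℝ) : Prop :=
  QuasiContinuous H f ∧ choquetIntegral H A (fun x => |f x|) < ⊤

/-- The `BMO^β(Q₀)` seminorm: `sup_{Q ⊆ Q₀} inf_{c ∈ ℝ} l(Q)^{-β} ∫_Q |u - c| d𝓗^β_∞`. -/
def bmoSeminorm (d : ℕ) (β : ℝ) (Q₀ : Set (Euc d)) (u : Euc d → ℝ) : ℝ≥0∞ :=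
  ⨆ (Q : Cube d) (_ : Q.set ⊆ Q₀),
    ⨅ c : ℝ, choquetIntegral (hausdorffContent d β) Q.set (fun x => |u x - c|) /
      ENNReal.ofReal (Q.side ^ β)

/-- Membership in `BMO^β(Q₀)`. -/
def MemBMO (d : ℕ) (β : ℝ) (Q₀ : Set (Euc d)) (u : Euc d → ℝ) : Prop :=
  MemChoquetL1 (hausdorffContent d β) Q₀ u ∧ bmoSeminorm d β Q₀ u < ⊤


/-- The classical John–Nirenberg BMO seminorm on `Q₀` with respect to Lebesgue measure. -/
def bmoClassical (d : ℕ) (Q₀ : Set (Euc d)) (u : Euc d → ℝ) : ℝ≥0∞ :=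
  ⨆ (Q : Cube d) (_ : Q.set ⊆ Q₀),
    (volume Q.set)⁻¹ * ∫⁻ x in Q.set, ENNReal.ofReal |u x - ⨍ y in Q.set, u y|

/-- The axis-parallel affine subspace of `ℝ^d` obtained by freeing the coordinates in `S`
and fixing the remaining coordinates to the values of `b`. -/
def hyperplane (d : ℕ) (S : Finset (Fin d)) (b : Fin d → ℝ) : Set (Euc d) :=
  {x : Euc d | ∀ i ∉ S, x i = b i}

/-- The classical BMO seminorm of `u` on `Q₀ ∩ H` with respect to the `k`-dimensional
Hausdorff measure `𝓗^k`, the supremum being over the subcubes `Q.set ∩ H ⊆ Q₀ ∩ H`. -/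
def bmoClassicalOnPlane (d k : ℕ) (Q₀ : Cube d) (H : Set (Euc d)) (u : Euc d → ℝ) : ℝ≥0∞ :=
  ⨆ (Q : Cube d) (_ : Q.set ∩ H ⊆ Q₀.set),
    (Measure.hausdorffMeasure (k : ℝ) (Q.set ∩ H))⁻¹ *
      ∫⁻ x in Q.set ∩ H,
        ENNReal.ofReal |u x - ⨍ y in Q.set ∩ H, u y ∂(Measure.hausdorffMeasure (k : ℝ))|
          ∂(Measure.hausdorffMeasure (k : ℝ))

/-- The unique dyadic cube of `𝓓(Q)` of generation `n` (side `l(Q)·2^{-n}`) containing `x`. -/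
def dyadicCubeAt {d : ℕ} (Q : Cube d) (n : ℕ) (x : Euc d) : Cube d where
  corner := fun i => Q.corner i + Q.side * (2 : ℝ)⁻¹ ^ n *
    (⌊(x i - Q.corner i) / (Q.side * (2 : ℝ)⁻¹ ^ n)⌋ : ℝ)
  side := Q.side * (2 : ℝ)⁻¹ ^ n
  side_pos := by have := Q.side_pos; positivity

/-- The dyadic `β`-Hausdorff maximal function associated to `𝓗^{β,Q}_∞`. -/
def dyadicMaximal (d : ℕ) (β : ℝ) (Q : Cube d) (f : Euc d → ℝ) (x : Euc d) : ℝ≥0∞ :=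
  ⨆ (Q' : Cube d) (_ : Q' ∈ Q.dyadic) (_ : x ∈ Q'.set),
    choquetIntegral (dyadicContent d β Q) Q'.set (fun y => |f y|) / ENNReal.ofReal (Q'.side ^ β)

/-- The `BMO^{β,p}(Q₀)` seminorm. -/
def bmoSeminormP (d : ℕ) (β p : ℝ) (Q₀ : Set (Euc d)) (u : Euc d → ℝ) : ℝ≥0∞ :=
  ⨆ (Q : Cube d) (_ : Q.set ⊆ Q₀),
    ⨅ c : ℝ, (choquetIntegral (hausdorffContent d β) Q.set (fun x => |u x - c| ^ p) /
      ENNReal.ofReal (Q.side ^ β)) ^ (1 / p)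

/-- The standard normalization constant `γ(α) = π^{d/2} 2^α Γ(α/2) / Γ((d-α)/2)`. -/
def rieszConst (d : ℕ) (α : ℝ) : ℝ :=
  Real.pi ^ ((d : ℝ) / 2) * 2 ^ α * Real.Gamma (α / 2) / Real.Gamma (((d : ℝ) - α) / 2)

/-- The Riesz potential `I_α μ (x) = γ(α)⁻¹ ∫ |x - y|^{α - d} dμ(y)`. -/
def rieszPotential (d : ℕ) (α : ℝ) (μ : Measure (Euc d)) (x : Euc d) : ℝ :=
  (rieszConst d α)⁻¹ * (∫⁻ y, ENNReal.ofReal (‖x - y‖ ^ (α - (d : ℝ))) ∂μ).toReal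

/-- The Morrey norm `‖μ‖_{ℳ^γ} = sup_{x, r>0} μ(B(x,r))/r^γ`. -/
def morreyNorm (d : ℕ) (γ : ℝ) (μ : Measure (Euc d)) : ℝ≥0∞ :=
  ⨆ (x : Euc d) (r : ℝ) (_ : 0 < r), μ (Metric.ball x r) / ENNReal.ofReal (r ^ γ)

/-- The dyadic `BMO^β_*(Q₀)` seminorm, where for each subcube `Q` the dyadic Hausdorff
content adapted to that `Q` is used. -/
def bmoDyadicSeminorm (d : ℕ) (β : ℝ) (Q₀ : Set (Euc d)) (u : Euc d → ℝ) : ℝ≥0∞ :=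
  ⨆ (Q : Cube d) (_ : Q.set ⊆ Q₀),
    ⨅ c : ℝ, choquetIntegral (dyadicContent d β Q) Q.set (fun x => |u x - c|) /
      ENNReal.ofReal (Q.side ^ β)

/-- A (possibly infinite) cube in `ℝ^d`: either a finite cube, or a product of intervals
which are infinite in every coordinate direction. -/
def IsGenCube (d : ℕ) (S : Set (Euc d)) : Prop :=
  (∃ Q : Cube d, S = Q.set) ∨
  (∃ I : Fin d → Set ℝ,
      (∀ i, (∃ a, I i = Set.Ici a) ∨ (∃ b, I i = Set.Iio b) ∨ I i = Set.univ) ∧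
      S = {x : Euc d | ∀ i, x i ∈ I i})

/-- The Choquet integral of an `ℝ≥0∞`-valued function. -/
def choquetIntegralE {X : Type*} (H : Set X → ℝ≥0∞) (f : X → ℝ≥0∞) : ℝ≥0∞ :=
  ∫⁻ t in Set.Ioi (0 : ℝ), H {x | ENNReal.ofReal t < f x}

namespace Cube

variable {d : ℕ} {Q P R : Cube d}

/-- Membership in a cube of the dyadic lattice in terms of floors of rescaled coordinates. -/
theorem mem_set_iff_floor {n : ℤ} {k : Fin d → ℤ} (hs : P.side = Q.side * 2 ^ n)
    (hc : ∀ i, P.corner i = Q.corner i + (k i : ℝ) * (Q.side * 2 ^ n)) (x : Euc d) :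
    x ∈ P.set ↔ ∀ i, ⌊(x i - Q.corner i) / (Q.side * 2 ^ n)⌋ = k i := by
  have hL : 0 < Q.side * (2 : ℝ) ^ n := hs ▸ P.side_pos
  refine forall_congr' fun i => ?_
  rw [Int.floor_eq_iff, hs, hc, le_div_iff₀ hL, div_lt_iff₀ hL]
  constructor <;> rintro ⟨h1, h2⟩ <;> constructor <;> linarith

/-- Two intersecting cubes of the dyadic lattice are nested. -/
theorem set_subset_of_mem_dyadic (hP : P ∈ Q.dyadic) (hR : R ∈ Q.dyadic)
    (hPR : P.side ≤ R.side) {x : Euc d} (hxP : x ∈ P.set) (hxR : x ∈ R.set) :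
    P.set ⊆ R.set := by
  obtain ⟨n, k, hs, hc⟩ := hP
  obtain ⟨m, l, hs', hc'⟩ := hR
  have hQ := Q.side_pos
  have hnm : n ≤ m := by
    rw [hs, hs'] at hPR
    exact (zpow_le_zpow_iff_right₀ (by norm_num : (1 : ℝ) < 2)).1 (le_of_mul_le_mul_left hPR hQ)
  obtain ⟨j, rfl⟩ := Int.le.dest hnm
  have key (z : ℝ) : ⌊z / (Q.side * 2 ^ (n + j : ℤ))⌋ =
      ⌊z / (Q.side * 2 ^ n)⌋ / ((2 ^ j : ℕ) : ℤ) := by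
    rw [← Int.floor_div_natCast, zpow_add₀ two_ne_zero, zpow_natCast, ← mul_assoc, div_div]
    push_cast
    rfl
  intro y hy
  rw [mem_set_iff_floor hs hc] at hxP hy
  rw [mem_set_iff_floor hs' hc'] at hxR ⊢
  intro i
  rw [← hxR i, key, key, hxP i, hy i]

theorem countable_dyadic (Q : Cube d) : Q.dyadic.Countable := by
  refine (Set.countable_range fun p : ℤ × (Fin d → ℤ) =>
    (⟨fun i => Q.corner i + (p.2 i : ℝ) * (Q.side * 2 ^ p.1), Q.side * 2 ^ p.1,
      mul_pos Q.side_pos (by positivity)⟩ : Cube d)).mono ?_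
  rintro ⟨c, s, hs⟩ ⟨n, k, h1, h2⟩
  refine ⟨(n, k), ?_⟩
  simp only at h1 h2
  simp only [Cube.mk.injEq, h1, and_true]
  ext i
  exact (h2 i).symm

/-- Every cube is nonempty. -/
theorem corner_mem (P : Cube d) : WithLp.toLp 2 P.corner ∈ P.set := fun i =>
  ⟨le_rfl, by simpa using P.side_pos⟩

theorem dist_le_of_mem {x y : Euc d} (hx : x ∈ P.set) (hy : y ∈ P.set) :
    dist x y ≤ √d * P.side := by
  rw [EuclideanSpace.dist_eq]
  have hP := P.side_pos
  rw [← Real.sqrt_sq hP.le, ← Real.sqrt_mul (Nat.cast_nonneg d)]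
  refine Real.sqrt_le_sqrt ?_
  have : ∀ i ∈ Finset.univ, dist (x i) (y i) ^ 2 ≤ P.side ^ 2 := fun i _ => by
    have h1 := hx i
    have h2 := hy i
    rw [Real.dist_eq, sq_abs]
    nlinarith
  simpa using Finset.sum_le_card_nsmul _ _ _ this

theorem ediam_set_le (P : Cube d) : Metric.ediam P.set ≤ ENNReal.ofReal (√d * P.side) :=
  Metric.ediam_le fun x hx y hy => by
    rw [edist_dist]
    exact ENNReal.ofReal_le_ofReal (dist_le_of_mem hx hy)

end Cube

section dyadicCubeAt

variable {d : ℕ} (Q : Cube d) {P : Cube d}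

theorem dyadicCubeAt_side_zpow (n : ℕ) (x : Euc d) :
    (dyadicCubeAt Q n x).side = Q.side * 2 ^ (-(n : ℤ)) := by
  simp [dyadicCubeAt]

theorem dyadicCubeAt_mem_dyadic (n : ℕ) (x : Euc d) : dyadicCubeAt Q n x ∈ Q.dyadic :=
  ⟨-(n : ℤ), fun i => ⌊(x i - Q.corner i) / (Q.side * (2 : ℝ)⁻¹ ^ n)⌋,
    dyadicCubeAt_side_zpow Q n x, fun i => by simp [dyadicCubeAt, mul_comm]⟩

theorem mem_dyadicCubeAt (n : ℕ) (x : Euc d) : x ∈ (dyadicCubeAt Q n x).set := by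
  rw [Cube.mem_set_iff_floor (Q := Q) (n := -(n : ℤ))
    (k := fun i => ⌊(x i - Q.corner i) / (Q.side * (2 : ℝ)⁻¹ ^ n)⌋)
    (dyadicCubeAt_side_zpow Q n x) (fun i => by simp [dyadicCubeAt, mul_comm])]
  intro i
  simp

/-- A cube of the dyadic lattice, no larger than those of generation `N`, is the cube of some
generation `n ≥ N` containing any prescribed one of its points. -/
theorem exists_eq_dyadicCubeAt {N : ℕ} {y : Euc d} (hP : P ∈ Q.dyadic)
    (hs : P.side ≤ (dyadicCubeAt Q N y).side) {x : Euc d} (hx : x ∈ P.set) :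
    ∃ n, N ≤ n ∧ P = dyadicCubeAt Q n x := by
  obtain ⟨m, k, hm, hc⟩ := id hP
  rw [dyadicCubeAt_side_zpow, hm] at hs
  have hmN : m ≤ -(N : ℤ) := (zpow_le_zpow_iff_right₀ (by norm_num : (1 : ℝ) < 2)).1
    (le_of_mul_le_mul_left hs Q.side_pos)
  obtain ⟨n, rfl⟩ : ∃ n : ℕ, m = -(n : ℤ) := ⟨(-m).toNat, by omega⟩
  refine ⟨n, by omega, ?_⟩
  rw [Cube.mem_set_iff_floor hm hc] at hx
  obtain ⟨c, s, hs0⟩ := P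
  simp only [dyadicCubeAt, Cube.mk.injEq] at hm hc ⊢
  simp only [zpow_neg, zpow_natCast] at hm hc hx
  refine ⟨?_, by simpa using hm⟩
  ext i
  rw [hc, ← hx]
  simp [mul_comm]

/-- If `P` meets the generation `n` cube around `x` but misses `x`, it lies inside that cube. -/
theorem subset_dyadicCubeAt (hP : P ∈ Q.dyadic) {n : ℕ} {x y : Euc d} (hx : x ∉ P.set)
    (hyP : y ∈ P.set) (hy : y ∈ (dyadicCubeAt Q n x).set) :
    P.set ⊆ (dyadicCubeAt Q n x).set := by
  rcases le_total P.side (dyadicCubeAt Q n x).side with h | h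
  · exact Cube.set_subset_of_mem_dyadic hP (dyadicCubeAt_mem_dyadic Q n x) h hyP hy
  · exact absurd (Cube.set_subset_of_mem_dyadic (dyadicCubeAt_mem_dyadic Q n x) hP h hy hyP
      (mem_dyadicCubeAt Q n x)) hx

theorem tendsto_dyadicCubeAt_side (x : Euc d) :
    Tendsto (fun n => (dyadicCubeAt Q n x).side) atTop (nhds 0) := by
  simpa [dyadicCubeAt] using
    (tendsto_pow_atTop_nhds_zero_of_lt_one (r := (2 : ℝ)⁻¹) (by norm_num) (by norm_num)).const_mul
      Q.side

/-- The dyadic cubes around `x` shrink to `x`. -/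
theorem eventually_dyadicCubeAt_subset {U : Set (Euc d)} {x : Euc d} (hU : U ∈ nhds x) :
    ∀ᶠ n in atTop, (dyadicCubeAt Q n x).set ⊆ U := by
  obtain ⟨ε, hε, hball⟩ := Metric.mem_nhds_iff.1 hU
  have h : Tendsto (fun n => √d * (dyadicCubeAt Q n x).side) atTop (nhds 0) := by
    simpa using (tendsto_dyadicCubeAt_side Q x).const_mul (√d)
  filter_upwards [h.eventually_lt_const hε] with n hn y hy
  exact hball ((Cube.dist_le_of_mem hy (mem_dyadicCubeAt Q n x)).trans_lt hn)

end dyadicCubeAt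

section dyadicContent

variable {d : ℕ} {β : ℝ} {Q : Cube d}

theorem exists_dyadic_cover_of_lt {E : Set (Euc d)} {r : ℝ≥0∞} (h : dyadicContent d β Q E < r) :
    ∃ c : ℕ → Cube d, (∀ i, c i ∈ Q.dyadic) ∧ E ⊆ ⋃ i, (c i).set ∧
      ∑' i, ENNReal.ofReal ((c i).side ^ β) < r := by
  simp only [dyadicContent, iInf_lt_iff] at h
  obtain ⟨c, h1, h2, h3⟩ := h
  exact ⟨c, h1, h2, h3⟩

theorem dyadicContent_le_tsum {E : Set (Euc d)} (c : ℕ → Cube d) (hc : ∀ i, c i ∈ Q.dyadic)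
    (hE : E ⊆ ⋃ i, (c i).set) :
    dyadicContent d β Q E ≤ ∑' i, ENNReal.ofReal ((c i).side ^ β) :=
  iInf_le_of_le c (iInf_le_of_le hc (iInf_le _ hE))

theorem dyadicContent_mono {E F : Set (Euc d)} (h : E ⊆ F) :
    dyadicContent d β Q E ≤ dyadicContent d β Q F :=
  iInf_mono fun _ => iInf_mono fun _ => iInf_mono' fun hF => ⟨h.trans hF, le_rfl⟩

theorem tendsto_ofReal_dyadicCubeAt_side_rpow (hβ : 0 < β) (x : Euc d) :
    Tendsto (fun n => ENNReal.ofReal ((dyadicCubeAt Q n x).side ^ β)) atTop (nhds 0) := by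
  have h := ENNReal.tendsto_ofReal
    ((tendsto_dyadicCubeAt_side Q x).rpow_const (p := β) (Or.inr hβ.le))
  simpa [Real.zero_rpow hβ.ne'] using h

/-- There are sequences of cubes of the dyadic lattice with arbitrarily small total content. -/
theorem exists_dyadic_tsum_lt (hβ : 0 < β) {ε : ℝ≥0∞} (hε : ε ≠ 0) :
    ∃ c : ℕ → Cube d, (∀ i, c i ∈ Q.dyadic) ∧ ∑' i, ENNReal.ofReal ((c i).side ^ β) < ε := by
  obtain ⟨δ, hδ, hsum⟩ := ENNReal.exists_pos_sum_of_countable hε ℕ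
  have h (i : ℕ) : ∃ n, ENNReal.ofReal ((dyadicCubeAt Q n 0).side ^ β) < δ i :=
    ((tendsto_ofReal_dyadicCubeAt_side_rpow hβ 0).eventually_lt_const
      (ENNReal.coe_pos.2 (hδ i))).exists
  choose n hn using h
  exact ⟨fun i => dyadicCubeAt Q (n i) 0, fun i => dyadicCubeAt_mem_dyadic Q _ _,
    (ENNReal.tsum_le_tsum fun i => (hn i).le).trans_lt hsum⟩

theorem dyadicContent_le_side (hβ : 0 < β) {P : Cube d} (hP : P ∈ Q.dyadic) {E : Set (Euc d)}
    (hE : E ⊆ P.set) : dyadicContent d β Q E ≤ ENNReal.ofReal (P.side ^ β) := by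
  refine ENNReal.le_of_forall_pos_le_add fun ε hε _ => ?_
  obtain ⟨c, hc, hsum⟩ := exists_dyadic_tsum_lt (Q := Q) hβ (ENNReal.coe_pos.2 hε).ne'
  refine (dyadicContent_le_tsum (fun i => Nat.casesOn i P c) ?_ ?_).trans ?_
  · rintro (_ | i)
    exacts [hP, hc i]
  · exact hE.trans (subset_iUnion_of_subset 0 subset_rfl)
  · rw [tsum_eq_zero_add' ENNReal.summable]
    exact add_le_add le_rfl hsum.le

theorem dyadicContent_empty (hβ : 0 < β) : dyadicContent d β Q ∅ = 0 :=
  le_antisymm (ge_of_tendsto' (tendsto_ofReal_dyadicCubeAt_side_rpow hβ 0) fun n =>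
    dyadicContent_le_side hβ (dyadicCubeAt_mem_dyadic Q n 0) (empty_subset _)) zero_le

theorem dyadicContent_iUnion_nat_le (E : ℕ → Set (Euc d)) :
    dyadicContent d β Q (⋃ i, E i) ≤ ∑' i, dyadicContent d β Q (E i) := by
  refine ENNReal.le_of_forall_pos_le_add fun ε hε hfin => ?_
  obtain ⟨δ, hδ, hsum⟩ := ENNReal.exists_pos_sum_of_countable (ENNReal.coe_pos.2 hε).ne' ℕ
  have h (i : ℕ) : dyadicContent d β Q (E i) < dyadicContent d β Q (E i) + δ i :=
    ENNReal.lt_add_right (ENNReal.ne_top_of_tsum_ne_top hfin.ne i) (ENNReal.coe_pos.2 (hδ i)).ne'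
  choose c hc hcov hlt using fun i => exists_dyadic_cover_of_lt (h i)
  refine (dyadicContent_le_tsum (fun n => c (Nat.unpair n).1 (Nat.unpair n).2)
    (fun n => hc _ _) ?_).trans ?_
  · refine iUnion_subset fun i x hx => ?_
    obtain ⟨j, hj⟩ := mem_iUnion.1 (hcov i hx)
    exact mem_iUnion.2 ⟨Nat.pair i j, by simpa using hj⟩
  · calc ∑' n, ENNReal.ofReal ((c (Nat.unpair n).1 (Nat.unpair n).2).side ^ β)
        = ∑' p : ℕ × ℕ, ENNReal.ofReal ((c p.1 p.2).side ^ β) :=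
          Nat.pairEquiv.symm.tsum_eq fun p : ℕ × ℕ => ENNReal.ofReal ((c p.1 p.2).side ^ β)
      _ = ∑' i, ∑' j, ENNReal.ofReal ((c i j).side ^ β) := ENNReal.tsum_prod'
      _ ≤ ∑' i, (dyadicContent d β Q (E i) + δ i) := ENNReal.tsum_le_tsum fun i => (hlt i).le
      _ ≤ _ := by
        rw [ENNReal.tsum_add]
        gcongr

/-- The dyadic Hausdorff content as an outer measure. -/
def dyadicOuterMeasure (Q : Cube d) (hβ : 0 < β) : OuterMeasure (Euc d) where
  measureOf := dyadicContent d β Q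
  empty := dyadicContent_empty hβ
  mono := dyadicContent_mono
  iUnion_nat E _ := dyadicContent_iUnion_nat_le E

theorem dyadicContent_iUnion_le (hβ : 0 < β) {ι : Type*} [Countable ι] (E : ι → Set (Euc d)) :
    dyadicContent d β Q (⋃ i, E i) ≤ ∑' i, dyadicContent d β Q (E i) :=
  measure_iUnion_le (μ := dyadicOuterMeasure Q hβ) E

theorem dyadicContent_union_le (hβ : 0 < β) (E F : Set (Euc d)) :
    dyadicContent d β Q (E ∪ F) ≤ dyadicContent d β Q E + dyadicContent d β Q F :=
  measure_union_le (μ := dyadicOuterMeasure Q hβ) E F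

/-- Sets of zero dyadic Hausdorff content have zero Hausdorff measure. -/
theorem hausdorffMeasure_eq_zero_of_dyadicContent (hβ : 0 < β) {E : Set (Euc d)}
    (h : dyadicContent d β Q E = 0) : (Measure.hausdorffMeasure β : Measure (Euc d)) E = 0 := by
  have hδ (m : ℕ) : dyadicContent d β Q E < ((m : ℝ≥0∞) + 1)⁻¹ := by simp [h]
  choose c hc hcov hlt using fun m => exists_dyadic_cover_of_lt (hδ m)
  have hδ0 : Tendsto (fun m : ℕ => ((m : ℝ≥0∞) + 1)⁻¹) atTop (nhds 0) := by
    simpa [Function.comp_def] using ENNReal.tendsto_inv_nat_nhds_zero.comp (tendsto_add_atTop_nat 1)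
  have hdiam (m i : ℕ) : Metric.ediam (c m i).set ≤
      ENNReal.ofReal √d * ENNReal.ofReal (c m i).side := by
    rw [← ENNReal.ofReal_mul (Real.sqrt_nonneg _)]
    exact (c m i).ediam_set_le
  have hsum0 : Tendsto (fun m => ENNReal.ofReal √d ^ β *
      ∑' i, ENNReal.ofReal ((c m i).side ^ β)) atTop (nhds 0) := by
    have : Tendsto (fun m => ∑' i, ENNReal.ofReal ((c m i).side ^ β)) atTop (nhds 0) :=
      tendsto_of_tendsto_of_tendsto_of_le_of_le tendsto_const_nhds hδ0 (fun _ => zero_le)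
        fun m => (hlt m).le
    simpa using ENNReal.Tendsto.const_mul this
      (Or.inr (ENNReal.rpow_ne_top_of_nonneg hβ.le ENNReal.ofReal_ne_top))
  have hr : Tendsto (fun m : ℕ => ENNReal.ofReal √d * (((m : ℝ≥0∞) + 1)⁻¹) ^ β⁻¹) atTop
      (nhds 0) := by
    have h1 := hδ0.ennrpow_const β⁻¹
    rw [ENNReal.zero_rpow_of_pos (inv_pos.2 hβ)] at h1
    simpa using ENNReal.Tendsto.const_mul h1 (Or.inr ENNReal.ofReal_ne_top)
  refine le_antisymm ((Measure.hausdorffMeasure_le_liminf_tsum β E _ hr (fun m i => (c m i).set)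
    (.of_forall fun m i => ?_) (.of_forall hcov)).trans ?_) zero_le
  · refine (hdiam m i).trans ?_
    gcongr
    rw [ENNReal.le_rpow_inv_iff hβ, ENNReal.ofReal_rpow_of_pos (c m i).side_pos]
    exact (ENNReal.le_tsum i).trans (hlt m).le
  · rw [← hsum0.liminf_eq]
    refine liminf_le_liminf (.of_forall fun m => ?_)
    rw [← ENNReal.tsum_mul_left]
    refine ENNReal.tsum_le_tsum fun i => ?_
    rw [← ENNReal.ofReal_rpow_of_pos (c m i).side_pos, ← ENNReal.mul_rpow_of_nonneg _ _ hβ.le]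
    exact ENNReal.rpow_le_rpow (hdiam m i) hβ.le

end dyadicContent

section density

variable {d : ℕ} {β : ℝ} {Q : Cube d}

theorem ofReal_side_rpow_pos (P : Cube d) : 0 < ENNReal.ofReal (P.side ^ β) :=
  ENNReal.ofReal_pos.2 (Real.rpow_pos_of_pos P.side_pos β)

/-- The points of `A` where the dyadic content density of `A` is bounded by some `r < 1` at all
small scales form a set of zero content. -/
theorem dyadicContent_low_density_eq_zero (hβ : 0 < β) (A : Set (Euc d)) {r : ℝ≥0∞} (hr : r < 1) :
    dyadicContent d β Q {x | x ∈ A ∧ ∀ᶠ n in atTop,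
      dyadicContent d β Q (A ∩ (dyadicCubeAt Q n x).set) ≤
        r * ENNReal.ofReal ((dyadicCubeAt Q n x).side ^ β)} = 0 := by
  set F : ℕ → Set (Euc d) := fun N => {x | x ∈ A ∧ ∀ n ≥ N,
      dyadicContent d β Q (A ∩ (dyadicCubeAt Q n x).set) ≤
        r * ENNReal.ofReal ((dyadicCubeAt Q n x).side ^ β)}
  have key (N : ℕ) (P : Cube d) (hP : P ∈ Q.dyadic) (hPs : P.side ≤ (dyadicCubeAt Q N 0).side) :
      dyadicContent d β Q (F N ∩ P.set) = 0 := by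
    have hdens (R : Cube d) (hR : R ∈ Q.dyadic) (hRs : R.side ≤ (dyadicCubeAt Q N 0).side)
        {x : Euc d} (hx : x ∈ F N) (hxR : x ∈ R.set) :
        dyadicContent d β Q (F N ∩ R.set) ≤ r * ENNReal.ofReal (R.side ^ β) := by
      obtain ⟨n, hn, rfl⟩ := exists_eq_dyadicCubeAt Q hR hRs hxR
      exact (dyadicContent_mono (inter_subset_inter_left _ fun y hy => hy.1)).trans (hx.2 n hn)
    have hfin : dyadicContent d β Q (F N ∩ P.set) ≠ ∞ :=
      ((dyadicContent_le_side hβ hP inter_subset_right).trans_lt ENNReal.ofReal_lt_top).ne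
    have hle : dyadicContent d β Q (F N ∩ P.set) ≤ r * dyadicContent d β Q (F N ∩ P.set) := by
      refine ENNReal.le_of_forall_pos_le_add fun ε hε _ => ?_
      obtain ⟨c, hc, hcov, hlt⟩ := exists_dyadic_cover_of_lt
        (ENNReal.lt_add_right hfin (ENNReal.coe_pos.2 hε).ne')
      have hpiece (i : ℕ) : dyadicContent d β Q (F N ∩ P.set ∩ (c i).set) ≤
          r * ENNReal.ofReal ((c i).side ^ β) := by
        rcases (F N ∩ P.set ∩ (c i).set).eq_empty_or_nonempty with he | ⟨x, ⟨hxF, hxP⟩, hxc⟩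
        · simp [he, dyadicContent_empty hβ]
        rcases le_total (c i).side P.side with h | h
        · exact (dyadicContent_mono (inter_subset_inter_left _ inter_subset_left)).trans
            (hdens (c i) (hc i) (h.trans hPs) hxF hxc)
        · refine (dyadicContent_mono inter_subset_left).trans ((hdens P hP hPs hxF hxP).trans ?_)
          gcongr
          exact P.side_pos.le
      calc dyadicContent d β Q (F N ∩ P.set)
          ≤ dyadicContent d β Q (⋃ i, F N ∩ P.set ∩ (c i).set) := dyadicContent_mono (by
            rw [← inter_iUnion]
            exact subset_inter subset_rfl hcov)
        _ ≤ ∑' i, r * ENNReal.ofReal ((c i).side ^ β) :=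
          (dyadicContent_iUnion_le hβ _).trans (ENNReal.tsum_le_tsum hpiece)
        _ ≤ r * (dyadicContent d β Q (F N ∩ P.set) + ε) := by
          rw [ENNReal.tsum_mul_left]
          gcongr
        _ ≤ r * dyadicContent d β Q (F N ∩ P.set) + ε := by
          rw [mul_add]
          gcongr
          exact mul_le_of_le_one_left' hr.le
    by_contra h0
    refine hle.not_gt ?_
    simpa using ENNReal.mul_lt_mul_left h0 hfin hr
  have hnull (N : ℕ) : dyadicOuterMeasure Q hβ
      (⋃ P ∈ {P : Cube d | P ∈ Q.dyadic ∧ P.side ≤ (dyadicCubeAt Q N 0).side}, F N ∩ P.set) = 0 :=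
    (measure_biUnion_null_iff (Q.countable_dyadic.mono fun P hP => hP.1)).2
      fun P hP => key N P hP.1 hP.2
  refine le_antisymm ((dyadicContent_mono ?_).trans
    (measure_iUnion_null hnull : dyadicOuterMeasure Q hβ _ = 0).le) zero_le
  rintro x ⟨hxA, hx⟩
  obtain ⟨N, hN⟩ := eventually_atTop.1 hx
  exact mem_iUnion.2 ⟨N, mem_biUnion (x := dyadicCubeAt Q N x)
    ⟨dyadicCubeAt_mem_dyadic Q N x, le_rfl⟩ ⟨⟨hxA, hN⟩, mem_dyadicCubeAt Q N x⟩⟩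

/-- A weak-type estimate for the dyadic maximal function of the discrete measure carried by a
countable family of cubes. -/
theorem mul_dyadicContent_maximal_le (hβ : 0 < β) {ι : Type*} (P : ι → Cube d) (r : ℝ≥0∞) :
    r * dyadicContent d β Q {x | ∃ n, r * ENNReal.ofReal ((dyadicCubeAt Q n x).side ^ β) ≤
        ∑' i, {i | (P i).set ⊆ (dyadicCubeAt Q n x).set}.indicator
          (fun i => ENNReal.ofReal ((P i).side ^ β)) i} ≤
      ∑' i, ENNReal.ofReal ((P i).side ^ β) := by
  classical
  set p : Cube d → Prop := fun R => r * ENNReal.ofReal (R.side ^ β) ≤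
    ∑' i, {i | (P i).set ⊆ R.set}.indicator (fun i => ENNReal.ofReal ((P i).side ^ β)) i
  set 𝓜 : Set (Cube d) := {R | R ∈ Q.dyadic ∧ p R ∧ ∃ (n : ℕ) (x : Euc d),
    R = dyadicCubeAt Q n x ∧ ∀ m < n, ¬ p (dyadicCubeAt Q m x)}
  have : Countable 𝓜 := (Q.countable_dyadic.mono fun R hR => hR.1).to_subtype
  have hdisj (R S : 𝓜) {y : Euc d} (hyR : y ∈ R.1.set) (hyS : y ∈ S.1.set) : R = S := by
    obtain ⟨R, hR, hpR, n, x, rfl, hx⟩ := R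
    obtain ⟨S, hS, hpS, m, z, rfl, hz⟩ := S
    have aux {n m : ℕ} {x z : Euc d} (hpS : p (dyadicCubeAt Q m z))
        (hx : ∀ m < n, ¬ p (dyadicCubeAt Q m x)) (hyR : y ∈ (dyadicCubeAt Q n x).set)
        (hyS : y ∈ (dyadicCubeAt Q m z).set)
        (h : (dyadicCubeAt Q n x).side ≤ (dyadicCubeAt Q m z).side) :
        dyadicCubeAt Q n x = dyadicCubeAt Q m z := by
      have hsub := Cube.set_subset_of_mem_dyadic (dyadicCubeAt_mem_dyadic Q n x)
        (dyadicCubeAt_mem_dyadic Q m z) h hyR hyS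
      obtain ⟨k, -, hk⟩ := exists_eq_dyadicCubeAt Q (dyadicCubeAt_mem_dyadic Q m z) (N := m)
        (y := z) le_rfl (hsub (mem_dyadicCubeAt Q n x))
      rw [hk] at h hpS ⊢
      have hnk : n ≤ k := not_lt.1 fun hlt => hx k hlt hpS
      have hkn : k ≤ n := by
        simp only [dyadicCubeAt] at h
        exact (pow_le_pow_iff_right_of_lt_one₀ (by norm_num) (by norm_num)).1
          (le_of_mul_le_mul_left h Q.side_pos)
      rw [le_antisymm hnk hkn]
    rcases le_total (dyadicCubeAt Q n x).side (dyadicCubeAt Q m z).side with h | h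
    · exact Subtype.ext (aux hpS hx hyR hyS h)
    · exact Subtype.ext (aux hpR hz hyS hyR h).symm
  calc _ ≤ r * dyadicContent d β Q (⋃ R : 𝓜, R.1.set) := by
        gcongr
        refine dyadicContent_mono fun x hx => ?_
        have hx' : ∃ n, p (dyadicCubeAt Q n x) := hx
        exact mem_iUnion.2 ⟨⟨_, dyadicCubeAt_mem_dyadic Q _ x, Nat.find_spec hx', _, x, rfl,
          fun m hm => Nat.find_min hx' hm⟩, mem_dyadicCubeAt Q _ x⟩
    _ ≤ r * ∑' R : 𝓜, ENNReal.ofReal (R.1.side ^ β) := by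
        gcongr
        exact (dyadicContent_iUnion_le hβ _).trans
          (ENNReal.tsum_le_tsum fun R => dyadicContent_le_side hβ R.2.1 subset_rfl)
    _ ≤ ∑' R : 𝓜, ∑' i, {i | (P i).set ⊆ R.1.set}.indicator
          (fun i => ENNReal.ofReal ((P i).side ^ β)) i := by
        rw [← ENNReal.tsum_mul_left]
        exact ENNReal.tsum_le_tsum fun R => R.2.2.1
    _ = ∑' i, ∑' R : 𝓜, {i | (P i).set ⊆ R.1.set}.indicator
          (fun i => ENNReal.ofReal ((P i).side ^ β)) i := ENNReal.tsum_comm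
    _ ≤ _ := by
        refine ENNReal.tsum_le_tsum fun i => ?_
        by_cases h : ∃ R : 𝓜, (P i).set ⊆ R.1.set
        · obtain ⟨R, hR⟩ := h
          rw [tsum_eq_single R]
          · exact indicator_le_self' (fun _ _ => zero_le) i
          · intro S hS
            refine indicator_of_notMem (fun hSi => hS ?_) _
            exact hdisj S R (hSi (P i).corner_mem) (hR (P i).corner_mem)
        · push Not at h
          refine (le_of_eq (ENNReal.tsum_eq_zero.2 fun R => ?_)).trans zero_le
          exact indicator_of_notMem (h R) _

end density

section upperDensity

variable {d : ℕ} {β : ℝ} {Q : Cube d}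

/-- Weak-type estimate for the sum of the dyadic content densities of countably many sets. -/
theorem dyadicContent_tsum_density_le (hβ : 0 < β) (B : ℕ → Set (Euc d)) {r η : ℝ≥0∞}
    (hr : r ≠ 0) (hr' : r ≠ ∞) (hB : ∑' k, dyadicContent d β Q (B k) < η) :
    dyadicContent d β Q {x | ∃ n, r * ENNReal.ofReal ((dyadicCubeAt Q n x).side ^ β) ≤
        ∑' k, dyadicContent d β Q (B k ∩ (dyadicCubeAt Q n x).set)} ≤ η + r⁻¹ * η := by
  obtain ⟨δ, hδ, hsum⟩ := ENNReal.exists_pos_sum_of_countable (tsub_pos_of_lt hB).ne' ℕ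
  have h (k : ℕ) : dyadicContent d β Q (B k) < dyadicContent d β Q (B k) + δ k :=
    ENNReal.lt_add_right (ENNReal.ne_top_of_tsum_ne_top hB.ne_top k)
      (ENNReal.coe_pos.2 (hδ k)).ne'
  choose c hc hcov hlt using fun k => exists_dyadic_cover_of_lt (h k)
  have htot : ∑' p : ℕ × ℕ, ENNReal.ofReal ((c p.1 p.2).side ^ β) ≤ η :=
    calc _ = ∑' k, ∑' j, ENNReal.ofReal ((c k j).side ^ β) := ENNReal.tsum_prod'
      _ ≤ ∑' k, (dyadicContent d β Q (B k) + δ k) := ENNReal.tsum_le_tsum fun k => (hlt k).le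
      _ ≤ ∑' k, dyadicContent d β Q (B k) + (η - ∑' k, dyadicContent d β Q (B k)) := by
        rw [ENNReal.tsum_add]
        gcongr
      _ = η := add_tsub_cancel_of_le hB.le
  have hmax := mul_dyadicContent_maximal_le (Q := Q) hβ (fun p : ℕ × ℕ => c p.1 p.2) r
  rw [ENNReal.mul_le_iff_le_inv hr hr'] at hmax
  refine (dyadicContent_mono (F := (⋃ p : ℕ × ℕ, (c p.1 p.2).set) ∪ _) fun x hx => ?_).trans
    ((dyadicContent_union_le hβ _ _).trans (add_le_add
      ((dyadicContent_iUnion_le hβ _).trans ((ENNReal.tsum_le_tsum fun p : ℕ × ℕ =>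
        dyadicContent_le_side hβ (hc p.1 p.2) subset_rfl).trans htot)) (hmax.trans (by gcongr))))
  by_cases hxc : x ∈ ⋃ p : ℕ × ℕ, (c p.1 p.2).set
  · exact Or.inl hxc
  refine Or.inr ?_
  obtain ⟨n, hn⟩ := hx
  refine ⟨n, hn.trans ?_⟩
  rw [ENNReal.tsum_prod']
  refine ENNReal.tsum_le_tsum fun k => ?_
  calc dyadicContent d β Q (B k ∩ (dyadicCubeAt Q n x).set)
      ≤ dyadicContent d β Q (⋃ j, (c k j).set ∩ (dyadicCubeAt Q n x).set) := by
        rw [← iUnion_inter]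
        exact dyadicContent_mono (inter_subset_inter_left _ (hcov k))
    _ ≤ ∑' j, dyadicContent d β Q ((c k j).set ∩ (dyadicCubeAt Q n x).set) :=
        dyadicContent_iUnion_le hβ _
    _ ≤ _ := ENNReal.tsum_le_tsum fun j => by
        by_cases hj : (c k j).set ⊆ (dyadicCubeAt Q n x).set
        · rw [indicator_of_mem (by exact hj)]
          exact dyadicContent_le_side hβ (hc k j) inter_subset_left
        · refine (le_of_eq ?_).trans zero_le
          rw [← dyadicContent_empty (d := d) (Q := Q) hβ]
          congr 1
          refine eq_empty_of_forall_notMem fun y hy => hj ?_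
          exact subset_dyadicCubeAt Q (hc k j) (fun hx => hxc (mem_iUnion.2 ⟨(k, j), hx⟩)) hy.1 hy.2

/-- If, outside of sets `O` of arbitrarily small content, the sets `A k` are locally contained in
`O`, then the sum of the dyadic content densities of the `A k` vanishes outside a null set. -/
theorem dyadicContent_frequently_density_eq_zero (hβ : 0 < β) (A : ℕ → Set (Euc d))
    (hA : ∑' k, dyadicContent d β Q (A k) ≠ ∞) (S : Set (Euc d))
    (hS : ∀ ε : ℝ, 0 < ε → ∃ O, dyadicContent d β Q O < ENNReal.ofReal ε ∧
      ∀ x ∈ S, x ∉ O → ∀ᶠ n in atTop, ∀ k, A k ∩ (dyadicCubeAt Q n x).set ⊆ O)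
    {r : ℝ≥0∞} (hr : r ≠ 0) (hr' : r ≠ ∞) :
    dyadicContent d β Q {x | x ∈ S ∧ ∃ᶠ n in atTop,
      r * ENNReal.ofReal ((dyadicCubeAt Q n x).side ^ β) ≤
        ∑' k, dyadicContent d β Q (A k ∩ (dyadicCubeAt Q n x).set)} = 0 := by
  by_contra h0
  have hC : (3 + r⁻¹ * 2 : ℝ≥0∞) ≠ ∞ := by finiteness
  obtain ⟨η, hη, hlt⟩ := ENNReal.exists_nnreal_pos_mul_lt hC h0
  refine hlt.not_ge ?_
  have hη' : (0 : ℝ≥0∞) < η := ENNReal.coe_pos.2 hη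
  obtain ⟨K, hK⟩ := ((ENNReal.tendsto_sum_nat_add _ hA).eventually_lt_const hη').exists
  have hε : 0 < (η : ℝ) / (K + 1) := by positivity
  obtain ⟨O, hO, hSO⟩ := hS _ hε
  have hO' : (K + 1 : ℝ≥0∞) * dyadicContent d β Q O ≤ η := by
    calc (K + 1 : ℝ≥0∞) * dyadicContent d β Q O
        ≤ ENNReal.ofReal (K + 1) * ENNReal.ofReal ((η : ℝ) / (K + 1)) := by
          gcongr
          rw [ENNReal.ofReal_add (by positivity) (by positivity)]
          simp
      _ = η := by
          rw [← ENNReal.ofReal_mul (by positivity), mul_div_cancel₀ _ (by positivity)]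
          simp
  have hB : ∑' k, dyadicContent d β Q (A k ∩ O) < 2 * η := by
    rw [← Summable.sum_add_tsum_nat_add' (k := K) ENNReal.summable, two_mul]
    refine ENNReal.add_lt_add_of_le_of_lt ?_ ?_ ?_
    · exact (ENNReal.sum_lt_top.2 fun k _ => ((dyadicContent_mono inter_subset_left).trans_lt
        (ENNReal.ne_top_of_tsum_ne_top hA k).lt_top)).ne
    · refine (Finset.sum_le_card_nsmul _ _ (dyadicContent d β Q O)
        fun k _ => dyadicContent_mono inter_subset_right).trans (le_trans ?_ hO')
      simp only [Finset.card_range, nsmul_eq_mul]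
      gcongr
      exact le_self_add
    · exact (ENNReal.tsum_le_tsum fun k => dyadicContent_mono inter_subset_left).trans_lt hK
  have hdens := dyadicContent_tsum_density_le (Q := Q) hβ (fun k => A k ∩ O) hr hr' hB
  set W : Set (Euc d) := {x | ∃ n, r * ENNReal.ofReal ((dyadicCubeAt Q n x).side ^ β) ≤
    ∑' k, dyadicContent d β Q (A k ∩ O ∩ (dyadicCubeAt Q n x).set)}
  calc _ ≤ dyadicContent d β Q (O ∪ W) := dyadicContent_mono fun x hx => ?_
    _ ≤ dyadicContent d β Q O + dyadicContent d β Q W := dyadicContent_union_le hβ _ _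
    _ ≤ η + (2 * η + r⁻¹ * (2 * η)) :=
      add_le_add ((le_mul_of_one_le_left' le_add_self).trans hO') hdens
    _ = η * (3 + r⁻¹ * 2) := by ring
  by_cases hxO : x ∈ O
  · exact Or.inl hxO
  obtain ⟨n, hn, hnO⟩ := (hx.2.and_eventually (hSO x hx.1 hxO)).exists
  exact Or.inr ⟨n, hn.trans (ENNReal.tsum_le_tsum fun k =>
    dyadicContent_mono fun y hy => ⟨⟨hy.1, hnO k hy⟩, hy.2⟩)⟩

end upperDensity

section layers

/-- The half-open intervals `(c k, c (k + 1)]` tile `(0, ∞)`. -/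
theorem iUnion_Ioc_mul_nat {c : ℝ} (hc : 0 < c) :
    ⋃ k : ℕ, Ioc (c * k) (c * (k + 1)) = Ioi 0 := by
  ext t
  simp only [mem_iUnion, mem_Ioc, mem_Ioi]
  refine ⟨fun ⟨k, hk, _⟩ => lt_of_le_of_lt (by positivity) hk, fun ht => ?_⟩
  obtain ⟨k, hk⟩ : ∃ k : ℕ, ⌈t / c⌉₊ = k + 1 :=
    Nat.exists_eq_succ_of_ne_zero (Nat.ceil_pos.2 (div_pos ht hc)).ne'
  have h := (Nat.ceil_eq_iff (by omega)).1 hk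
  rw [lt_div_iff₀ hc, div_le_iff₀ hc] at h
  push_cast at h
  exact ⟨k, by simpa [mul_comm] using h.1, by simpa [mul_comm] using h.2⟩

theorem tsum_le_lintegral_of_antitone {g : ℝ → ℝ≥0∞} (hg : Antitone g) {c : ℝ} (hc : 0 < c) :
    ∑' k : ℕ, g (c * (k + 1)) * ENNReal.ofReal c ≤ ∫⁻ t in Ioi 0, g t := by
  have hd : Pairwise (Function.onFun Disjoint fun k : ℕ => Ioc (c * k) (c * (k + 1))) := by
    have := (show Monotone fun k : ℕ => c * (k : ℝ) from fun a b h => by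
      simp only; gcongr).pairwise_disjoint_on_Ioc_succ
    simpa using this
  rw [← iUnion_Ioc_mul_nat hc, lintegral_iUnion (fun _ => measurableSet_Ioc) hd]
  refine ENNReal.tsum_le_tsum fun k => ?_
  calc g (c * (k + 1)) * ENNReal.ofReal c = ∫⁻ _ in Ioc (c * k) (c * (k + 1)), g (c * (k + 1)) := by
        rw [setLIntegral_const, Real.volume_Ioc]
        ring_nf
    _ ≤ _ := setLIntegral_mono' measurableSet_Ioc fun t ht => hg ht.2

theorem lintegral_le_tsum_of_antitone {g : ℝ → ℝ≥0∞} (hg : Antitone g) {c : ℝ} (hc : 0 < c) :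
    ∫⁻ t in Ioi 0, g t ≤ ∑' k : ℕ, g (c * k) * ENNReal.ofReal c := by
  rw [← iUnion_Ioc_mul_nat hc]
  refine (lintegral_iUnion_le _ _).trans (ENNReal.tsum_le_tsum fun k => ?_)
  calc _ ≤ ∫⁻ _ in Ioc (c * k) (c * (k + 1)), g (c * k) :=
        setLIntegral_mono' measurableSet_Ioc fun t ht => hg ht.1.le
    _ = g (c * k) * ENNReal.ofReal c := by
        rw [setLIntegral_const, Real.volume_Ioc]
        ring_nf

end layers

section differentiation

variable {d : ℕ} {β : ℝ} {Q : Cube d} {f : Euc d → ℝ}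

theorem antitone_dyadicContent_superlevel (E : Set (Euc d)) :
    Antitone fun t : ℝ => dyadicContent d β Q {x | x ∈ E ∧ t < f x} :=
  fun _ _ h => dyadicContent_mono fun _ hx => ⟨hx.1, h.trans_lt hx.2⟩

/-- The upper dyadic average of `f` is almost everywhere at least `f`. -/
theorem ae_le_limsup_choquetIntegral_div (hβ : 0 < β) (f : Euc d → ℝ) :
    ∀ᵐ x ∂(Measure.hausdorffMeasure β : Measure (Euc d)),
      ENNReal.ofReal (f x) ≤ Filter.limsup (fun n : ℕ =>
          choquetIntegral (dyadicContent d β Q) (dyadicCubeAt Q n x).set f /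
            ENNReal.ofReal ((dyadicCubeAt Q n x).side ^ β)) Filter.atTop := by
  have hae (s c : ℚ) : ∀ᵐ x ∂(Measure.hausdorffMeasure β : Measure (Euc d)),
      0 < s → s < c → (c : ℝ) < f x → ∃ᶠ n in atTop,
        ENNReal.ofReal (s / c) * ENNReal.ofReal ((dyadicCubeAt Q n x).side ^ β) <
          dyadicContent d β Q ({y | (c : ℝ) < f y} ∩ (dyadicCubeAt Q n x).set) := by
    by_cases h : 0 < s ∧ s < c
    · have hr : ENNReal.ofReal ((s : ℝ) / c) < 1 := by
        rw [ENNReal.ofReal_lt_one, div_lt_one (by exact_mod_cast h.1.trans h.2)]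
        exact_mod_cast h.2
      refine measure_mono_null (fun x hx => ?_) (hausdorffMeasure_eq_zero_of_dyadicContent hβ
        (dyadicContent_low_density_eq_zero (Q := Q) hβ {y | (c : ℝ) < f y} hr))
      simp only [mem_compl_iff, mem_ofPred_eq, Classical.not_imp, not_frequently, not_lt] at hx
      exact hx.2.2
    · exact .of_forall fun x h1 h2 => absurd ⟨h1, h2⟩ h
  filter_upwards [ae_all_iff.2 fun s => ae_all_iff.2 (hae s)] with x hx
  refine ENNReal.le_of_forall_nnreal_lt fun a ha => ?_
  rw [← ENNReal.ofReal_coe_nnreal, ENNReal.ofReal_lt_ofReal_iff_of_nonneg a.coe_nonneg] at ha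
  obtain ⟨s, has, hsf⟩ := exists_rat_btwn ha
  obtain ⟨c, hsc, hcf⟩ := exists_rat_btwn hsf
  have hs : (0 : ℝ) < s := a.coe_nonneg.trans_lt has
  have hc : (0 : ℝ) < c := hs.trans hsc
  refine le_limsup_of_frequently_le ?_
  refine (hx s c (by exact_mod_cast hs) (by exact_mod_cast hsc) hcf).mono fun n hn => ?_
  rw [ENNReal.le_div_iff_mul_le (Or.inl (ofReal_side_rpow_pos _).ne') (Or.inl ENNReal.ofReal_ne_top)]
  calc (a : ℝ≥0∞) * ENNReal.ofReal ((dyadicCubeAt Q n x).side ^ β)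
      ≤ ENNReal.ofReal c * (ENNReal.ofReal (s / c) *
          ENNReal.ofReal ((dyadicCubeAt Q n x).side ^ β)) := by
        rw [← mul_assoc, ← ENNReal.ofReal_mul hc.le, mul_div_cancel₀ _ hc.ne',
          ← ENNReal.ofReal_coe_nnreal]
        gcongr
    _ ≤ ENNReal.ofReal c * dyadicContent d β Q
          ({y | (c : ℝ) < f y} ∩ (dyadicCubeAt Q n x).set) := by gcongr
    _ = ∫⁻ _ in Ioc (0 : ℝ) c, dyadicContent d β Q
          ({y | (c : ℝ) < f y} ∩ (dyadicCubeAt Q n x).set) := by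
        rw [setLIntegral_const, Real.volume_Ioc, sub_zero, mul_comm]
    _ ≤ ∫⁻ t in Ioc (0 : ℝ) c, dyadicContent d β Q {y | y ∈ (dyadicCubeAt Q n x).set ∧ t < f y} :=
        setLIntegral_mono' measurableSet_Ioc fun t ht =>
          dyadicContent_mono fun y hy => ⟨hy.2, ht.2.trans_lt hy.1⟩
    _ ≤ _ := lintegral_mono_set Ioc_subset_Ioi_self

/-- The upper dyadic average of an integrable function `f` is almost everywhere at most `f`. -/
theorem ae_limsup_choquetIntegral_div_le (hβ : 0 < β) (hf0 : ∀ x, 0 ≤ f x)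
    (hf : MemChoquetL1 (dyadicContent d β Q) Set.univ f) :
    ∀ᵐ x ∂(Measure.hausdorffMeasure β : Measure (Euc d)),
      Filter.limsup (fun n : ℕ =>
          choquetIntegral (dyadicContent d β Q) (dyadicCubeAt Q n x).set f /
            ENNReal.ofReal ((dyadicCubeAt Q n x).side ^ β)) Filter.atTop ≤
        ENNReal.ofReal (f x) := by
  obtain ⟨hqc, hint⟩ := hf
  simp only [abs_of_nonneg (hf0 _)] at hint
  set A : ℚ → ℕ → Set (Euc d) := fun c k => {y | (c : ℝ) * (k + 1) < f y}
  have hsum (c : ℚ) (hc : (0 : ℝ) < c) : ∑' k, dyadicContent d β Q (A c k) ≠ ∞ := by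
    have h := (tsum_le_lintegral_of_antitone
      (antitone_dyadicContent_superlevel (β := β) (Q := Q) (f := f) univ) hc).trans_lt hint
    simp only [mem_univ, true_and] at h
    rw [ENNReal.tsum_mul_right] at h
    exact (ENNReal.lt_top_of_mul_ne_top_left h.ne (ENNReal.ofReal_pos.2 hc).ne').ne
  have hae (c r : ℚ) : ∀ᵐ x ∂(Measure.hausdorffMeasure β : Measure (Euc d)),
      0 < r → f x < c → ∀ᶠ n in atTop,
        ∑' k, dyadicContent d β Q (A c k ∩ (dyadicCubeAt Q n x).set) ≤
          ENNReal.ofReal r * ENNReal.ofReal ((dyadicCubeAt Q n x).side ^ β) := by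
    by_cases h : 0 < r ∧ 0 < c
    · have hc : (0 : ℝ) < c := by exact_mod_cast h.2
      have hr : (0 : ℝ) < r := by exact_mod_cast h.1
      refine measure_mono_null (fun x hx => ?_) (hausdorffMeasure_eq_zero_of_dyadicContent hβ
        (dyadicContent_frequently_density_eq_zero (Q := Q) hβ (A c) (hsum c hc) {x | f x < c}
          (fun ε hε => ?_) (ENNReal.ofReal_pos.2 hr).ne' ENNReal.ofReal_ne_top))
      · simp only [mem_compl_iff, mem_ofPred_eq, Classical.not_imp, not_eventually, not_le] at hx
        exact ⟨hx.2.1, hx.2.2.mono fun n hn => hn.le⟩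
      · obtain ⟨O, -, hO, hcont⟩ := hqc ε hε
        refine ⟨O, hO, fun x hx hxO => ?_⟩
        have hU := mem_nhdsWithin_iff_exists_mem_nhds_inter.1
          ((hcont x hxO).eventually_lt continuousWithinAt_const (g := fun _ => (c : ℝ)) hx)
        obtain ⟨U, hU, hUO⟩ := hU
        filter_upwards [eventually_dyadicCubeAt_subset Q hU] with n hn k y hy
        by_contra hyO
        have h1 : f y < c := hUO ⟨hn hy.2, hyO⟩
        have h2 : (c : ℝ) * (k + 1) < f y := hy.1
        have h3 : (c : ℝ) * 1 ≤ c * (k + 1) := by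
          gcongr
          simp
        linarith
    · refine .of_forall fun x h1 h2 => absurd ⟨h1, ?_⟩ h
      exact_mod_cast (hf0 x).trans_lt h2
  filter_upwards [ae_all_iff.2 fun c => ae_all_iff.2 (hae c)] with x hx
  have hbound (c r : ℚ) (hr : 0 < r) (hc : f x < c) : Filter.limsup (fun n : ℕ =>
      choquetIntegral (dyadicContent d β Q) (dyadicCubeAt Q n x).set f /
        ENNReal.ofReal ((dyadicCubeAt Q n x).side ^ β)) Filter.atTop ≤
        ENNReal.ofReal (c * (1 + r)) := by
    have hc0 : (0 : ℝ) < c := (hf0 x).trans_lt hc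
    have hr0 : (0 : ℝ) < r := by exact_mod_cast hr
    refine limsup_le_of_le (h := ?_)
    filter_upwards [hx c r hr hc] with n hn
    rw [ENNReal.div_le_iff_le_mul (Or.inl (ofReal_side_rpow_pos _).ne')
      (Or.inl ENNReal.ofReal_ne_top)]
    refine (lintegral_le_tsum_of_antitone (antitone_dyadicContent_superlevel _) hc0).trans ?_
    rw [ENNReal.tsum_mul_right, tsum_eq_zero_add' ENNReal.summable,
      ENNReal.ofReal_mul hc0.le, ENNReal.ofReal_add zero_le_one hr0.le, ENNReal.ofReal_one,
      mul_comm, mul_assoc, add_mul, one_mul]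
    gcongr
    · exact dyadicContent_le_side hβ (dyadicCubeAt_mem_dyadic Q n x) fun y hy => hy.1
    · refine le_trans (ENNReal.tsum_le_tsum fun k => dyadicContent_mono fun y hy => ?_) hn
      exact ⟨by simpa [A] using hy.2, hy.1⟩
  refine ENNReal.le_of_forall_pos_le_add fun ε hε _ => ?_
  obtain ⟨c, hfc, hcε⟩ := exists_rat_btwn (lt_add_of_pos_right (f x) (NNReal.coe_pos.2 hε))
  have hc0 : (0 : ℝ) < c := (hf0 x).trans_lt hfc
  obtain ⟨r, hr, hrε⟩ := exists_rat_btwn (sub_pos.2 ((one_lt_div hc0).2 hcε))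
  refine (hbound c r (by exact_mod_cast hr) hfc).trans ?_
  rw [← ENNReal.ofReal_coe_nnreal, ← ENNReal.ofReal_add (hf0 x) ε.coe_nonneg]
  refine ENNReal.ofReal_le_ofReal ?_
  rw [lt_sub_iff_add_lt', lt_div_iff₀ hc0] at hrε
  rw [mul_comm]
  exact hrε.le

end differentiation

theorem dyadicContent_differentiation (d : ℕ) (hd : 1 ≤ d) (β : ℝ) (hβ : 0 < β)
    (hβd : β ≤ (d : ℝ)) (Q : Cube d) (f : Euc d → ℝ) (hf0 : ∀ x, 0 ≤ f x)
    (hf : MemChoquetL1 (dyadicContent d β Q) Set.univ f) :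
    ∀ᵐ x ∂(Measure.hausdorffMeasure β : Measure (Euc d)),
      Filter.limsup (fun n : ℕ =>
          choquetIntegral (dyadicContent d β Q) (dyadicCubeAt Q n x).set f /
            ENNReal.ofReal ((dyadicCubeAt Q n x).side ^ β)) Filter.atTop =
        ENNReal.ofReal (f x) := by
  filter_upwards [ae_limsup_choquetIntegral_div_le hβ hf0 hf,
    ae_le_limsup_choquetIntegral_div (Q := Q) hβ f] with x hle hge
  exact le_antisymm hle hge

end
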